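/- arXiv:2505.00944 — 2 statements merged into one kernel-verified Lean document; each statement's English description precedes it below -/
import Mathlib

section
/- For 0 ≤ t ≤ 1 and p > -1, with ℰ, ℰ' i.i.d. standard exponentials and ℰ_t = (ℰ−1) − t(ℰ'−1), one has E|ℰ_t|^p = (e^{t-1}/(1+t))·(∫₀^{1-t} x^p e^x dx + Γ(p+1)) + (t/(1+t))·E[(tℰ + 1−t)^p]. -/
open MeasureTheory ProbabilityTheory Real Set

/-- Density of a standard exponential random variable. -/
noncomputable def expPDF : ℝ → ℝ := fun x => if 0 < x then Real.exp (-x) else 0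

/-- `X` has density `f` with respect to Lebesgue measure. -/
def HasDensity {Ω : Type*} [MeasurableSpace Ω] (P : Measure Ω) (X : Ω → ℝ) (f : ℝ → ℝ) : Prop :=
  Measurable X ∧ Measure.map X P = volume.withDensity (fun x => ENNReal.ofReal (f x))

lemma aux_int {F : Type*} [NormedAddCommGroup F] [NormedSpace ℝ F] (g : ℝ → F) :
    ∫ x, g x ∂(volume.withDensity (fun x => ENNReal.ofReal (expPDF x))) =
      ∫ x in Ioi (0:ℝ), Real.exp (-x) • g x := by
  have hm : Measurable expPDF := by
    unfold expPDF
    exact Measurable.ite measurableSet_Ioi (by fun_prop) (by fun_prop)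
  rw [integral_withDensity_eq_integral_toReal_smul hm.ennreal_ofReal (by simp),
    ← integral_indicator measurableSet_Ioi]
  congr 1
  ext x
  by_cases hx : 0 < x
  · simp [expPDF, hx, (Real.exp_pos _).le]
  · simp [expPDF, hx]

lemma aux_integrable (g : ℝ → ℝ)
    (h : IntegrableOn (fun x => Real.exp (-x) * g x) (Ioi 0)) :
    Integrable g (volume.withDensity (fun x => ENNReal.ofReal (expPDF x))) := by
  have hm : Measurable expPDF := by
    unfold expPDF
    exact Measurable.ite measurableSet_Ioi (by fun_prop) (by fun_prop)
  rw [integrable_withDensity_iff_integrable_smul' hm.ennreal_ofReal (by simp)]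
  rw [← integrable_indicator_iff measurableSet_Ioi] at h
  refine h.congr (ae_of_all _ fun x => ?_)
  by_cases hx : 0 < x
  · simp [expPDF, hx, (Real.exp_pos _).le]
  · simp [expPDF, hx]

lemma aux_charFun (s : ℝ) :
    charFun (volume.withDensity (fun x => ENNReal.ofReal (expPDF x))) s
      = 1 / (1 - s * Complex.I) := by
  rw [charFun_apply_real, aux_int]
  have := integral_exp_mul_complex_Ioi (a := -1 + s * Complex.I) (by simp) 0
  have h2 : (1 - s * Complex.I) ≠ 0 := by
    intro h; have := congrArg Complex.re h; simp at this
  have h3 : (-1 + s * Complex.I) ≠ 0 := by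
    intro h; have := congrArg Complex.re h; simp at this
  calc _ = ∫ x : ℝ in Ioi 0, Complex.exp ((-1 + s * Complex.I) * x) := by
        congr 1; ext x
        rw [Complex.real_smul, Complex.ofReal_exp, ← Complex.exp_add]
        congr 1; push_cast; ring
    _ = _ := by
        rw [this]; simp only [Complex.ofReal_zero, mul_zero, Complex.exp_zero]
        field_simp
        ring

lemma aux_shift_integrable (g : ℝ → ℝ) (a : ℝ) (h : IntegrableOn g (Ioi a)) :
    IntegrableOn (fun x => g (x + a)) (Ioi 0) := by
  have := ((measurePreserving_add_right volume a).integrableOn_comp_preimage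
    (measurableEmbedding_addRight a) (f := g) (s := Ioi a)).2 h
  simpa [Function.comp_def] using this

lemma aux_shift_int (g : ℝ → ℝ) (a : ℝ) :
    ∫ x in Ioi (0:ℝ), g (x + a) = ∫ x in Ioi a, g x := by
  have := (measurePreserving_add_right volume a).setIntegral_preimage_emb
    (measurableEmbedding_addRight a) g (Ioi a)
  simpa using this

/-- The law of the difference is a mixture of scaled exponentials. -/
lemma aux_law {Ω : Type} [MeasurableSpace Ω] (P : Measure Ω) [IsProbabilityMeasure P]
    (E E' : Ω → ℝ) (hE : HasDensity P E expPDF) (hE' : HasDensity P E' expPDF)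
    (hind : IndepFun E E' P) (t : ℝ) (ht0 : 0 ≤ t) :
    P.map (E + fun ω => (-t) * E' ω) =
      ENNReal.ofReal (1 / (1 + t)) • P.map E +
      ENNReal.ofReal (t / (1 + t)) • (P.map E).map ((-t) * ·) := by
  have hEm := hE.1
  have hEm' := hE'.1
  have : IsProbabilityMeasure (P.map E) := Measure.isProbabilityMeasure_map hEm.aemeasurable
  have hfin (c : ℝ) (ν : Measure ℝ) [IsFiniteMeasure ν] :
      IsFiniteMeasure (ENNReal.ofReal c • ν) := ν.smul_finite (by simp)
  have i1 := hfin (1 / (1 + t)) (P.map E)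
  have i2 := hfin (t / (1 + t)) ((P.map E).map ((-t) * ·))
  apply Measure.ext_of_charFun
  have hi : IndepFun E (fun ω => (-t) * E' ω) P :=
    hind.comp measurable_id (measurable_const_mul (-t))
  rw [hi.charFun_map_add_eq_mul hEm.aemeasurable (by fun_prop)]
  ext s
  have hb (ν : Measure ℝ) [IsFiniteMeasure ν] :
      Integrable (fun x : ℝ => Complex.exp (s * x * Complex.I)) ν := by
    refine Integrable.of_bound (C := 1) (by fun_prop) (ae_of_all _ fun x => ?_)
    rw [← Complex.ofReal_mul, Complex.norm_exp_ofReal_mul_I]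
  rw [Pi.mul_apply, charFun_map_mul_comp hEm'.aemeasurable, charFun_apply_real (μ := _ + _),
    integral_add_measure (hb _) (hb _), integral_smul_measure, integral_smul_measure,
    ← charFun_apply_real, ← charFun_apply_real, charFun_map_mul, hE.2, hE'.2,
    aux_charFun, aux_charFun, ENNReal.toReal_ofReal (by positivity),
    ENNReal.toReal_ofReal (by positivity), Complex.real_smul, Complex.real_smul]
  have h2 (r : ℝ) : (1 - r * Complex.I) ≠ 0 := by
    intro h; have := congrArg Complex.re h; simp at this
  have h3 : (1 + t : ℂ) ≠ 0 := by
    exact_mod_cast (by positivity : (1 + t) ≠ 0)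
  have h4 := h2 s
  have h5 := h2 (-t * s)
  push_cast at h5 ⊢
  simp only [neg_mul, sub_neg_eq_add] at h5 ⊢
  have h6 : (1 + t * s * Complex.I) + t * (1 - s * Complex.I) = (1 + t : ℂ) := by ring
  generalize (1 + t * s * Complex.I : ℂ) = A at *
  generalize (1 - s * Complex.I : ℂ) = B at *
  field_simp
  linear_combination -h6

/-- `|x - a|^p` against the exponential density. -/
lemma aux_abs (a : ℝ) (ha : 0 ≤ a) (p : ℝ) (hp : -1 < p) :
    IntegrableOn (fun x => Real.exp (-x) * |x - a| ^ p) (Ioi 0) ∧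
    ∫ x in Ioi (0:ℝ), Real.exp (-x) * |x - a| ^ p =
      Real.exp (-a) * ((∫ x in (0:ℝ)..a, x ^ p * Real.exp x) + Real.Gamma (p + 1)) := by
  have hG := Real.GammaIntegral_convergent (s := p + 1) (by linarith)
  have hGv := Real.Gamma_eq_integral (s := p + 1) (by linarith)
  simp only [add_sub_cancel_right] at hG hGv
  have ht1 : IntegrableOn (fun x => Real.exp (-x) * |x - a| ^ p) (Ioi a) := by
    have h2 : IntegrableOn (fun x => Real.exp (-(x + -a)) * (x + -a) ^ p) (Ioi a) := by
      have := ((measurePreserving_add_right volume (-a)).integrableOn_comp_preimage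
        (measurableEmbedding_addRight (-a)) (f := fun x => Real.exp (-x) * x ^ p)
        (s := Ioi 0)).2 hG
      simpa [Function.comp_def] using this
    refine IntegrableOn.congr_fun (h2.const_mul (Real.exp (-a))) (fun x hx => ?_) measurableSet_Ioi
    have hx' : a < x := hx
    rw [abs_of_pos (by linarith), ← mul_assoc, ← Real.exp_add]
    congr 2; ring
  have ht2 : ∫ x in Ioi a, Real.exp (-x) * |x - a| ^ p = Real.exp (-a) * Real.Gamma (p + 1) := by
    rw [← aux_shift_int, hGv, ← integral_const_mul]
    refine setIntegral_congr_fun measurableSet_Ioi fun x hx => ?_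
    have hx' : 0 < x := hx
    simp only [add_sub_cancel_right]
    rw [abs_of_pos hx', ← mul_assoc, ← Real.exp_add]
    congr 2; ring
  have hb0 : IntervalIntegrable (fun x : ℝ => x ^ p * Real.exp x) volume 0 a :=
    (intervalIntegral.intervalIntegrable_rpow' hp).mul_continuousOn (by fun_prop)
  have heq : EqOn (fun x => Real.exp (-a) * ((a - x) ^ p * Real.exp (a - x)))
      (fun x => Real.exp (-x) * |x - a| ^ p) (Ioc 0 a) := by
    intro x hx
    simp only
    rw [abs_of_nonpos (by linarith [hx.2]), neg_sub, mul_comm ((a - x) ^ p), ← mul_assoc,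
      ← Real.exp_add]
    congr 2; ring
  have hb1 : IntegrableOn (fun x => Real.exp (-x) * |x - a| ^ p) (Ioc 0 a) := by
    have h := (hb0.comp_sub_left a).symm
    simp only [sub_self, sub_zero] at h
    rw [intervalIntegrable_iff_integrableOn_Ioc_of_le ha] at h
    exact IntegrableOn.congr_fun (h.const_mul (Real.exp (-a))) heq measurableSet_Ioc
  have hb2 : ∫ x in Ioc 0 a, Real.exp (-x) * |x - a| ^ p =
      Real.exp (-a) * ∫ x in (0:ℝ)..a, x ^ p * Real.exp x := by
    rw [← setIntegral_congr_fun measurableSet_Ioc heq, integral_const_mul,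
      ← intervalIntegral.integral_of_le ha,
      intervalIntegral.integral_comp_sub_left (fun x => x ^ p * Real.exp x) a]
    simp
  rw [← Ioc_union_Ioi_eq_Ioi ha]
  refine ⟨hb1.union ht1, ?_⟩
  rw [setIntegral_union (Ioc_disjoint_Ioi le_rfl) measurableSet_Ioi hb1 ht1, hb2, ht2, mul_add]

lemma aux_lin (t : ℝ) (ht : 0 < t) (a : ℝ) (ha : 0 ≤ a) (p : ℝ) (hp : -1 < p) :
    IntegrableOn (fun x => Real.exp (-x) * (t * x + a) ^ p) (Ioi 0) := by
  have h := integrableOn_rpow_mul_exp_neg_mul_rpow (p := 1) (s := p) (b := t⁻¹) hp one_pos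
    (by positivity)
  have h2 := aux_shift_integrable _ a (h.mono_set (Ioi_subset_Ioi ha))
  have h3 := (integrableOn_Ioi_comp_mul_left_iff _ 0 ht).2 (by simpa only [mul_zero] using h2)
  refine IntegrableOn.congr_fun (h3.const_mul (Real.exp (t⁻¹ * a))) (fun x hx => ?_)
    measurableSet_Ioi
  simp only [Real.rpow_one]
  rw [mul_comm ((t * x + a) ^ p), ← mul_assoc, ← Real.exp_add]
  congr 2
  field_simp
  ring

theorem stmt_9 {Ω : Type} [MeasurableSpace Ω] (P : Measure Ω) [IsProbabilityMeasure P]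
    (E E' : Ω → ℝ) (hE : HasDensity P E expPDF) (hE' : HasDensity P E' expPDF)
    (hind : IndepFun E E' P)
    (t : ℝ) (ht0 : 0 ≤ t) (ht1 : t ≤ 1) (p : ℝ) (hp : -1 < p) :
    (∫ ω, |(E ω - 1) - t * (E' ω - 1)| ^ p ∂P) =
      (Real.exp (t - 1) / (1 + t)) *
        ((∫ x in (0 : ℝ)..(1 - t), x ^ p * Real.exp x) + Real.Gamma (p + 1)) +
      (t / (1 + t)) * ∫ ω, (t * E ω + 1 - t) ^ p ∂P := by
  have hEm := hE.1
  have hEm' := hE'.1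
  have ha : 0 ≤ 1 - t := by linarith
  obtain ⟨hA1, hA2⟩ := aux_abs (1 - t) ha p hp
  have hfm : Measurable (fun u : ℝ => |u - (1 - t)| ^ p) := by fun_prop
  have hL : (∫ ω, |(E ω - 1) - t * (E' ω - 1)| ^ p ∂P) =
      ∫ u, |u - (1 - t)| ^ p ∂(P.map (E + fun ω => (-t) * E' ω)) := by
    rw [integral_map (by fun_prop) hfm.aestronglyMeasurable]
    congr 1; ext ω
    simp only [Pi.add_apply]
    congr 2; ring
  have hR : ∫ ω, (t * E ω + 1 - t) ^ p ∂P =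
      ∫ x in Ioi (0:ℝ), Real.exp (-x) • (t * x + 1 - t) ^ p := by
    rw [← aux_int, ← hE.2, integral_map hEm.aemeasurable]
    exact (by fun_prop : Measurable (fun x : ℝ => (t * x + 1 - t) ^ p)).aestronglyMeasurable
  have heq : EqOn (fun x => Real.exp (-x) * (t * x + (1 - t)) ^ p)
      (fun x => Real.exp (-x) * |-t * x - (1 - t)| ^ p) (Ioi 0) := by
    intro x hx
    have hx' : 0 < x := hx
    have : 0 ≤ t * x := by positivity
    simp only
    rw [abs_of_nonpos (by linarith)]
    congr 2; ring
  have hI1 : Integrable (fun u : ℝ => |u - (1 - t)| ^ p) (P.map E) := by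
    rw [hE.2]; exact aux_integrable _ hA1
  have hI2 : Integrable (fun u : ℝ => |u - (1 - t)| ^ p)
      (ENNReal.ofReal (t / (1 + t)) • (P.map E).map ((-t) * ·)) := by
    rcases ht0.eq_or_lt with h | h
    · subst h; simp
    · refine Integrable.smul_measure ?_ (by simp)
      rw [integrable_map_measure hfm.aestronglyMeasurable (by fun_prop), hE.2]
      exact aux_integrable _ ((aux_lin t h _ ha p hp).congr_fun heq measurableSet_Ioi)
  rw [hL, aux_law P E E' hE hE' hind t ht0,
    integral_add_measure (hI1.smul_measure (by simp)) hI2, integral_smul_measure,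
    integral_smul_measure, hE.2, integral_map (by fun_prop) hfm.aestronglyMeasurable, aux_int,
    aux_int, hR, ENNReal.toReal_ofReal (by positivity), ENNReal.toReal_ofReal (by positivity)]
  simp only [smul_eq_mul]
  rw [hA2, ← setIntegral_congr_fun measurableSet_Ioi heq, neg_sub]
  simp only [add_sub_assoc]
  ring
end

section
/- For every p with 1 ≤ p ≤ 3 and 0 ≤ t ≤ 1/5, E|ℰ_t/μ_t|^{p₀} ≤ Γ(p₀+1) where p₀ ∈ (2.9414, 2.9415) is the unique root in (1,∞) of Γ(p+1) = (e/2)^p E|ℰ−1|^p; more concretely, for 0 ≤ t ≤ 1/5 one has (e^{t-1}/(1+t))(∫₀^{1-t} x^{p₀}e^x dx + Γ(p₀+1)) + (t/(1+t))(2t³+3t²+1) ≤ μ_t^{p₀}Γ(p₀+1) with μ_t = (2/e)e^t/(1+t). -/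
open MeasureTheory ProbabilityTheory Real Set

/-- Set integral form of integration against the exponential law. -/
lemma aux_int_density (f : ℝ → ℝ) :
    ∫ x, f x ∂(volume.withDensity (fun x => ENNReal.ofReal (expPDF x)))
      = ∫ x in Ioi (0:ℝ), Real.exp (-x) * f x := by
  have hm : Measurable expPDF := by
    unfold expPDF
    exact Measurable.ite measurableSet_Ioi (by fun_prop) (by fun_prop)
  rw [integral_withDensity_eq_integral_toReal_smul (by fun_prop) (by simp)]
  rw [← integral_indicator measurableSet_Ioi]
  congr 1
  ext x
  by_cases hx : 0 < x
  · simp [expPDF, hx, (Real.exp_pos _).le]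
  · simp [expPDF, hx]

lemma aux_integrable_density (f : ℝ → ℝ)
    (hf : Integrable f (volume.withDensity (fun x => ENNReal.ofReal (expPDF x)))) :
    IntegrableOn (fun x => Real.exp (-x) * f x) (Ioi (0:ℝ)) := by
  have hm : Measurable expPDF := by
    unfold expPDF
    exact Measurable.ite measurableSet_Ioi (by fun_prop) (by fun_prop)
  rw [integrable_withDensity_iff_integrable_smul' (by fun_prop) (by simp)] at hf
  rw [← integrable_indicator_iff measurableSet_Ioi]
  refine hf.congr (Filter.Eventually.of_forall ?_)
  intro x
  by_cases hx : 0 < x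
  · simp [expPDF, hx, (Real.exp_pos _).le]
  · simp [expPDF, hx]

lemma aux_inner (p : ℝ) (hp : 0 < p) (c : ℝ) (hc : 0 ≤ c) :
    ∫ x in Ioi (0:ℝ), Real.exp (-x) * |x - c| ^ p
      = Real.exp (-c) * ((∫ u in (0:ℝ)..c, u ^ p * Real.exp u) + Real.Gamma (p + 1)) := by
  have hcont : Continuous (fun x : ℝ => Real.exp (-x) * |x - c| ^ p) := by
    refine Continuous.mul (by fun_prop) ?_
    exact Continuous.rpow_const (by fun_prop) (fun _ => Or.inr hp.le)
  have hG := Real.GammaIntegral_convergent (s := p + 1) (by linarith)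
  have hsub : (fun x : ℝ => Real.exp (-x) * |x - c| ^ p) =
      fun x => (fun u : ℝ => Real.exp (-c) * (Real.exp (-u) * |u| ^ p)) (x - c) := by
    ext x
    have : Real.exp (-x) = Real.exp (-c) * Real.exp (-(x - c)) := by
      rw [← Real.exp_add]; congr 1; ring
    simp only [this]; ring
  have hG2 : IntegrableOn (fun u : ℝ => Real.exp (-c) * (Real.exp (-u) * |u| ^ p)) (Ioi 0) := by
    refine Integrable.const_mul ?_ _
    refine (integrableOn_congr_fun ?_ measurableSet_Ioi).mp hG
    intro x hx
    simp only [add_sub_cancel_right]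
    rw [abs_of_pos hx]
  have hI2 : IntegrableOn (fun x : ℝ => Real.exp (-x) * |x - c| ^ p) (Ioi c) := by
    rw [hsub]
    have := (measurePreserving_sub_right (volume : Measure ℝ) c).integrableOn_comp_preimage
      (MeasurableEquiv.subRight c).measurableEmbedding
      (f := fun u : ℝ => Real.exp (-c) * (Real.exp (-u) * |u| ^ p)) (s := Ioi 0)
    have h2 := this.mpr hG2
    have h3 : Ioi c = (fun x => x - c) ⁻¹' Ioi 0 := by ext x; simp
    rw [h3]
    exact h2
  have hI1 : IntegrableOn (fun x : ℝ => Real.exp (-x) * |x - c| ^ p) (Ioc 0 c) :=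
    (hcont.integrableOn_Icc).mono_set Ioc_subset_Icc_self
  rw [← Ioc_union_Ioi_eq_Ioi hc, setIntegral_union (Ioc_disjoint_Ioi le_rfl) measurableSet_Ioi
    hI1 hI2, mul_add]
  congr 1
  · rw [← intervalIntegral.integral_of_le hc]
    have := intervalIntegral.integral_comp_sub_left (a := 0) (b := c)
      (fun u : ℝ => Real.exp (-c) * (u ^ p * Real.exp u)) c
    rw [← intervalIntegral.integral_const_mul]
    simp only [sub_self, sub_zero] at this
    rw [← this]
    apply intervalIntegral.integral_congr
    intro x hx
    rw [uIcc_of_le hc] at hx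
    have h1 : |x - c| = c - x := by rw [abs_sub_comm, abs_of_nonneg]; linarith [hx.2]
    have h2 : Real.exp (-x) = Real.exp (-c) * Real.exp (c - x) := by
      rw [← Real.exp_add]; congr 1; ring
    simp only [h1, h2]; ring
  · have h3 : ∫ x in Ioi c, Real.exp (-x) * |x - c| ^ p =
        ∫ u in Ioi (0:ℝ), Real.exp (-c) * (Real.exp (-u) * |u| ^ p) := by
      have := (measurePreserving_sub_right (volume : Measure ℝ) c).setIntegral_preimage_emb
        (MeasurableEquiv.subRight c).measurableEmbedding
        (fun u : ℝ => Real.exp (-c) * (Real.exp (-u) * |u| ^ p)) (Ioi 0)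
      rw [← this, hsub]
      congr 2
      ext x; simp
    rw [h3, integral_const_mul, Real.Gamma_eq_integral (by linarith)]
    congr 1
    apply setIntegral_congr_fun measurableSet_Ioi
    intro x hx
    simp only [add_sub_cancel_right]
    rw [abs_of_pos hx]

lemma aux_mom (n : ℕ) : IntegrableOn (fun y : ℝ => Real.exp (-y) * y ^ n) (Ioi 0) ∧
    ∫ y in Ioi (0:ℝ), Real.exp (-y) * y ^ n = n.factorial := by
  have hpos : (0:ℝ) < n + 1 := by positivity
  constructor
  · simpa using Real.GammaIntegral_convergent (s := n + 1) hpos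
  · rw [← Real.Gamma_nat_eq_factorial, Real.Gamma_eq_integral hpos]
    simp

lemma aux_cube (t a b : ℝ) :
    IntegrableOn (fun y : ℝ => Real.exp (-y) * (a + b * (1 - t + t * y) ^ 3)) (Ioi 0) ∧
    ∫ y in Ioi (0:ℝ), Real.exp (-y) * (a + b * (1 - t + t * y) ^ 3)
      = a + b * (2 * t ^ 3 + 3 * t ^ 2 + 1) := by
  obtain ⟨i0, e0⟩ := aux_mom 0
  obtain ⟨i1, e1⟩ := aux_mom 1
  obtain ⟨i2, e2⟩ := aux_mom 2
  obtain ⟨i3, e3⟩ := aux_mom 3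
  have j0 := i0.const_mul (a + b * (1 - t) ^ 3)
  have j1 := i1.const_mul (b * (3 * (1 - t) ^ 2 * t))
  have j2 := i2.const_mul (b * (3 * (1 - t) * t ^ 2))
  have j3 := i3.const_mul (b * t ^ 3)
  have hE : (fun y : ℝ => Real.exp (-y) * (a + b * (1 - t + t * y) ^ 3)) =
      fun y => (((a + b * (1 - t) ^ 3) * (Real.exp (-y) * y ^ 0) +
       (b * (3 * (1 - t) ^ 2 * t)) * (Real.exp (-y) * y ^ 1)) +
       (b * (3 * (1 - t) * t ^ 2)) * (Real.exp (-y) * y ^ 2)) +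
       (b * t ^ 3) * (Real.exp (-y) * y ^ 3) := by
    ext y; ring
  rw [hE]
  refine ⟨((j0.add j1).add j2).add j3, ?_⟩
  rw [integral_add (by exact (j0.add j1).add j2) j3, integral_add (by exact j0.add j1) j2,
    integral_add j0 j1]
  simp only [integral_const_mul, e0, e1, e2, e3]
  simp [Nat.factorial]
  ring

lemma aux_amgm (p : ℝ) (hp : 0 < p) (hp3 : p ≤ 3) (c : ℝ) (hc : 0 ≤ c) :
    c ^ p ≤ (1 - p / 3) + (p / 3) * c ^ 3 := by
  have := Real.geom_mean_le_arith_mean2_weighted (w₁ := 1 - p / 3) (w₂ := p / 3) (p₁ := 1)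
    (p₂ := c ^ 3) (by linarith) (by positivity) zero_le_one (by positivity) (by ring)
  rw [Real.one_rpow, one_mul, ← Real.rpow_natCast c 3, ← Real.rpow_mul hc] at this
  have h3 : ((3:ℕ):ℝ) * (p / 3) = p := by push_cast; ring
  rw [h3] at this
  rw [Real.rpow_natCast] at this
  linarith

lemma aux_outer (p : ℝ) (hp : 0 < p) (hp3 : p ≤ 3) (t : ℝ) (ht0 : 0 ≤ t) (ht1 : t ≤ 1)
    (h : ℝ → ℝ) (hh : ∀ c, h c = Real.exp (-c) *
      ((∫ u in (0:ℝ)..c, u ^ p * Real.exp u) + Real.Gamma (p + 1)))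
    (hint : IntegrableOn (fun y => Real.exp (-y) * h (1 - t + t * y)) (Ioi 0)) :
    ∫ y in Ioi (0:ℝ), Real.exp (-y) * h (1 - t + t * y) ≤
      (h (1 - t) + t * (2 * t ^ 3 + 3 * t ^ 2 + 1)) / (1 + t) := by
  have hcontp : Continuous (fun u : ℝ => u ^ p) :=
    Continuous.rpow_const continuous_id (fun _ => Or.inr hp.le)
  have hcont : Continuous (fun u : ℝ => u ^ p * Real.exp u) := hcontp.mul Real.continuous_exp
  have hd : ∀ c, HasDerivAt h (c ^ p - h c) c := by
    intro c
    have h1 : HasDerivAt (fun c => ∫ u in (0:ℝ)..c, u ^ p * Real.exp u) (c ^ p * Real.exp c) c :=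
      intervalIntegral.integral_hasDerivAt_right (hcont.intervalIntegrable _ _)
        hcont.stronglyMeasurable.stronglyMeasurableAtFilter hcont.continuousAt
    have h2 : HasDerivAt (fun c : ℝ => Real.exp (-c)) (-Real.exp (-c)) c := by
      simpa using (hasDerivAt_neg c).exp
    have h3 := h2.mul (h1.add_const (Real.Gamma (p + 1)))
    have h4 : h = fun c => Real.exp (-c) *
      ((∫ u in (0:ℝ)..c, u ^ p * Real.exp u) + Real.Gamma (p + 1)) := funext hh
    rw [h4]
    refine h3.congr_deriv ?_
    have : Real.exp (-c) * Real.exp c = 1 := by rw [← Real.exp_add]; simp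
    linear_combination (c ^ p) * this
  have hD : ∀ y, HasDerivAt (fun y => Real.exp (-y) * h (1 - t + t * y))
      (t * (Real.exp (-y) * (1 - t + t * y) ^ p)
        - (1 + t) * (Real.exp (-y) * h (1 - t + t * y))) y := by
    intro y
    have h2 : HasDerivAt (fun c : ℝ => Real.exp (-c)) (-Real.exp (-y)) y := by
      simpa using (hasDerivAt_neg y).exp
    have h1 : HasDerivAt (fun y : ℝ => 1 - t + t * y) t y := by
      simpa using ((hasDerivAt_id y).const_mul t).const_add (1 - t)
    have h3 := h2.mul ((hd (1 - t + t * y)).comp y h1)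
    refine h3.congr_deriv ?_
    simp only [Function.comp]
    ring
  obtain ⟨ci, ce⟩ := aux_cube t (1 - p / 3) (p / 3)
  have hle : ∀ y ∈ Ioi (0:ℝ), Real.exp (-y) * (1 - t + t * y) ^ p ≤
      Real.exp (-y) * ((1 - p / 3) + (p / 3) * (1 - t + t * y) ^ 3) := by
    intro y hy
    have : 0 ≤ t * y := mul_nonneg ht0 (le_of_lt hy)
    exact mul_le_mul_of_nonneg_left (aux_amgm p hp hp3 _ (by linarith)) (Real.exp_pos _).le
  have hpi : IntegrableOn (fun y : ℝ => Real.exp (-y) * (1 - t + t * y) ^ p) (Ioi 0) := by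
    refine Integrable.mono' ci ?_ ?_
    · exact Continuous.aestronglyMeasurable
        ((by fun_prop : Continuous fun y : ℝ => Real.exp (-y)).mul
          (hcontp.comp (by fun_prop : Continuous fun y : ℝ => 1 - t + t * y)))
    · refine (ae_restrict_iff' measurableSet_Ioi).mpr (Filter.Eventually.of_forall ?_)
      intro y hy
      have : 0 ≤ t * y := mul_nonneg ht0 (le_of_lt hy)
      rw [Real.norm_of_nonneg]
      · exact hle y hy
      · exact mul_nonneg (Real.exp_pos _).le (Real.rpow_nonneg (by linarith) _)
  have hDi : IntegrableOn (fun y => t * (Real.exp (-y) * (1 - t + t * y) ^ p)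
        - (1 + t) * (Real.exp (-y) * h (1 - t + t * y))) (Ioi 0) :=
    (hpi.const_mul t).sub (hint.const_mul (1 + t))
  have hT := tendsto_zero_of_hasDerivAt_of_integrableOn_Ioi (a := (0:ℝ)) (fun y _ => hD y) hDi hint
  have hF := integral_Ioi_of_hasDerivAt_of_tendsto' (a := (0:ℝ)) (fun y _ => hD y) hDi hT
  rw [integral_sub (hpi.const_mul t) (hint.const_mul (1 + t)), integral_const_mul,
    integral_const_mul] at hF
  have hb := setIntegral_mono_on hpi ci measurableSet_Ioi hle
  rw [ce] at hb
  have hb2 : (1 - p / 3) + (p / 3) * (2 * t ^ 3 + 3 * t ^ 2 + 1) ≤ 2 * t ^ 3 + 3 * t ^ 2 + 1 := by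
    have : 0 ≤ (1 - p / 3) * (2 * t ^ 3 + 3 * t ^ 2) := mul_nonneg (by linarith) (by positivity)
    linarith
  have hb3 := mul_le_mul_of_nonneg_left (hb.trans hb2) ht0
  simp only [neg_zero, Real.exp_zero, mul_zero, add_zero, one_mul] at hF
  rw [le_div_iff₀ (by linarith)]
  linarith

lemma aux_gamma (p : ℝ) (h1 : 2.9414 < p) (h2 : p < 2.9415) : 4.9 ≤ Real.Gamma (p + 1) := by
  have g4 : Real.Gamma 4 = 6 := by
    have h := Real.Gamma_nat_eq_factorial 3
    have e : ((3:ℕ):ℝ) + 1 = 4 := by norm_num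
    rw [e] at h
    rw [h]; norm_num [Nat.factorial]
  have g5 : Real.Gamma 5 = 24 := by
    have h := Real.Gamma_nat_eq_factorial 4
    have e : ((4:ℕ):ℝ) + 1 = 5 := by norm_num
    rw [e] at h
    rw [h]; norm_num [Nat.factorial]
  have hs : (0:ℝ) < 5 - (p + 1) := by linarith
  have := Real.convexOn_Gamma.2 (show p + 1 ∈ Ioi (0:ℝ) by simp; linarith)
    (show (5:ℝ) ∈ Ioi (0:ℝ) by simp)
    (show 0 ≤ 1 / (5 - (p + 1)) by positivity)
    (show 0 ≤ (4 - (p + 1)) / (5 - (p + 1)) from div_nonneg (by linarith) hs.le)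
    (by field_simp; ring)
  have he : (1 / (5 - (p + 1))) • (p + 1) + ((4 - (p + 1)) / (5 - (p + 1))) • (5:ℝ) = 4 := by
    simp only [smul_eq_mul]; field_simp; ring
  rw [he, g4, g5] at this
  simp only [smul_eq_mul] at this
  have h6 : 6 * (5 - (p + 1)) ≤ Real.Gamma (p + 1) + (4 - (p + 1)) * 24 := by
    have := mul_le_mul_of_nonneg_right this hs.le
    have e : (1 / (5 - (p + 1)) * Real.Gamma (p + 1) + (4 - (p + 1)) / (5 - (p + 1)) * 24) *
      (5 - (p + 1)) = Real.Gamma (p + 1) + (4 - (p + 1)) * 24 := by field_simp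
    linarith
  linarith

lemma aux_log (t : ℝ) (ht0 : 0 ≤ t) (ht1 : t ≤ 1 / 5) :
    t ^ 2 / 2 - t ^ 3 / 2 ≤ t - Real.log (1 + t) := by
  have h : Real.log (1 + t) ≤ t - t ^ 2 / 2 + t ^ 3 / 2 := by
    rw [Real.log_le_iff_le_exp (by linarith)]
    have hu : 0 ≤ t - t ^ 2 / 2 + t ^ 3 / 2 := by nlinarith [pow_nonneg ht0 3]
    refine le_trans ?_ (Real.quadratic_le_exp_of_nonneg hu)
    have : 0 ≤ t ^ 4 * (5 / 4 - t / 2 + t ^ 2 / 4) := mul_nonneg (by positivity) (by nlinarith)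
    nlinarith
  linarith

lemma aux_J (t : ℝ) : ∫ x in (1 - t)..(1:ℝ), x ^ 3 * Real.exp x
    = -2 * Real.exp 1 + (2 + 3 * t + t ^ 3) * Real.exp (1 - t) := by
  have hd : ∀ x ∈ uIcc (1 - t) (1:ℝ), HasDerivAt
      (fun x : ℝ => (x ^ 3 - 3 * x ^ 2 + 6 * x - 6) * Real.exp x) (x ^ 3 * Real.exp x) x := by
    intro x _
    have h1 : HasDerivAt (fun x : ℝ => x ^ 3 - 3 * x ^ 2 + 6 * x - 6)
        (3 * x ^ 2 - 6 * x + 6) x := by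
      have := ((((hasDerivAt_pow 3 x).sub ((hasDerivAt_pow 2 x).const_mul 3)).add
        ((hasDerivAt_id x).const_mul 6)).sub_const 6)
      refine this.congr_deriv ?_
      norm_num; ring
    refine (h1.mul (Real.hasDerivAt_exp x)).congr_deriv ?_
    ring
  rw [intervalIntegral.integral_eq_sub_of_hasDerivAt hd
    (Continuous.intervalIntegrable (by fun_prop) _ _)]
  ring

lemma aux_num (t s : ℝ) (ht0 : 0 ≤ t) (ht1 : t ≤ 1 / 5) (hs : 9.5 * (t ^ 2 / 2 - t ^ 3 / 2) ≤ s) :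
    0 ≤ s + (-2 * Real.exp 1 + (2 + 3 * t + t ^ 3) * Real.exp (1 - t))
      - t * Real.exp (1 - t) * (2 * t ^ 3 + 3 * t ^ 2 + 1) := by
  have he : Real.exp (1 - t) = Real.exp 1 * Real.exp (-t) := by
    rw [← Real.exp_add]; congr 1
  have hb := Real.exp_bound (x := -t) (by rw [abs_neg, abs_of_nonneg ht0]; linarith) (n := 4)
    (by norm_num)
  rw [abs_neg, abs_of_nonneg ht0] at hb
  have hb2 := (abs_le.mp hb).1
  simp [Finset.sum_range_succ, Nat.factorial] at hb2
  have hx : 1 - t + t ^ 2 / 2 - t ^ 3 / 6 - t ^ 4 * (5 / 96) ≤ Real.exp (-t) := by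
    nlinarith [hb2]
  have he1 : Real.exp 1 ≤ 2.7183 := by linarith [Real.exp_one_lt_d9]
  have he0 : 0 < Real.exp 1 := Real.exp_pos 1
  have hq : 0 ≤ t ^ 2 / 2 - t ^ 3 / 2 := by nlinarith [sq_nonneg t]
  have hs2 : Real.exp 1 * (3.49 * (t ^ 2 / 2 - t ^ 3 / 2)) ≤ s := by nlinarith
  have hf : 0 ≤ 2 * (1 + t) * (1 - t ^ 3) := by
    have : t ^ 3 ≤ 1 := pow_le_one₀ ht0 (by linarith)
    exact mul_nonneg (by linarith) (by linarith)
  have hx2 := mul_le_mul_of_nonneg_left hx hf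
  have key : 0 ≤ 3.49 * (t ^ 2 / 2 - t ^ 3 / 2) - 2 + 2 * (1 + t) * (1 - t ^ 3) * Real.exp (-t) := by
    refine le_trans ?_ (add_le_add_right hx2 _)
    have : 3.49 * (t ^ 2 / 2 - t ^ 3 / 2) - 2 + 2 * (1 + t) * (1 - t ^ 3) *
      (1 - t + t ^ 2 / 2 - t ^ 3 / 6 - t ^ 4 * (5 / 96)) = t ^ 2 * (0.745 - (4/3 + 1.745) * t
       - (7/16) * t ^ 2 + (43/48) * t ^ 3 - (2/3) * t ^ 4 + (7/16) * t ^ 5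
       + (5/48) * t ^ 6) := by ring
    rw [this]
    apply mul_nonneg (sq_nonneg t)
    have h3 : 0 ≤ t ^ 3 * (43 / 48 - (2/3) * t) := mul_nonneg (by positivity) (by linarith)
    have h5 : 0 ≤ t ^ 5 := by positivity
    have h6 : 0 ≤ t ^ 6 := by positivity
    nlinarith
  have := mul_nonneg he0.le key
  rw [he]
  nlinarith

lemma aux_second (p : ℝ) (hp1 : 2.9414 < p) (hp2 : p < 2.9415)
    (hG : Real.Gamma (p + 1) = (Real.exp 1 / 2) ^ p * (Real.exp (-1) *
      ((∫ u in (0:ℝ)..1, u ^ p * Real.exp u) + Real.Gamma (p + 1))))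
    (t : ℝ) (ht0 : 0 ≤ t) (ht1 : t ≤ 1 / 5) :
    (Real.exp (t - 1) / (1 + t)) *
        ((∫ x in (0 : ℝ)..(1 - t), x ^ p * Real.exp x) + Real.Gamma (p + 1)) +
      (t / (1 + t)) * (2 * t ^ 3 + 3 * t ^ 2 + 1) ≤
      ((2 / Real.exp 1) * Real.exp t / (1 + t)) ^ p * Real.Gamma (p + 1) := by
  have hp : 0 < p := by linarith
  have hcontp : Continuous (fun u : ℝ => u ^ p) :=
    Continuous.rpow_const continuous_id (fun _ => Or.inr hp.le)
  have hcont : Continuous (fun u : ℝ => u ^ p * Real.exp u) := hcontp.mul Real.continuous_exp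
  have hsplit := intervalIntegral.integral_add_adjacent_intervals
    (hcont.intervalIntegrable (μ := volume) 0 (1 - t)) (hcont.intervalIntegrable (1 - t) 1)
  have hJ : ∫ x in (1 - t)..(1:ℝ), x ^ 3 * Real.exp x ≤
      ∫ x in (1 - t)..(1:ℝ), x ^ p * Real.exp x := by
    refine intervalIntegral.integral_mono_on (by linarith)
      (Continuous.intervalIntegrable (by fun_prop) _ _) (hcont.intervalIntegrable _ _) ?_
    intro x hx
    refine mul_le_mul_of_nonneg_right ?_ (Real.exp_pos _).le
    rw [← Real.rpow_natCast x 3]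
    exact Real.rpow_le_rpow_of_exponent_ge (by linarith [hx.1]) hx.2 (by push_cast; linarith)
  rw [aux_J] at hJ
  have hK1 : 0 ≤ ∫ u in (0:ℝ)..1, u ^ p * Real.exp u := by
    refine intervalIntegral.integral_nonneg zero_le_one ?_
    intro x hx
    exact mul_nonneg (Real.rpow_nonneg hx.1 _) (Real.exp_pos _).le
  have hGam := aux_gamma p hp1 hp2
  set K1 := ∫ u in (0:ℝ)..1, u ^ p * Real.exp u with hK1d
  set Kt := ∫ u in (0:ℝ)..(1 - t), u ^ p * Real.exp u with hKtd
  set J := ∫ u in (1 - t)..(1:ℝ), u ^ p * Real.exp u with hJd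
  set G := Real.Gamma (p + 1) with hGd
  have h1t : 0 < 1 + t := by linarith
  set w := Real.exp t / (1 + t) with hw
  have hwpos : 0 < w := by positivity
  have hlw : Real.log w = t - Real.log (1 + t) := by
    rw [hw, Real.log_div (Real.exp_pos _).ne' h1t.ne', Real.log_exp]
  have hR : ((2 / Real.exp 1) * Real.exp t / (1 + t)) ^ p * G =
      Real.exp (-1) * (K1 + G) * (w * w ^ (p - 1)) := by
    have e1 : (2 / Real.exp 1) * Real.exp t / (1 + t) = (2 / Real.exp 1) * w := by
      rw [hw]; ring
    have e2 : w * w ^ (p - 1) = w ^ p := by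
      rw [Real.rpow_sub_one hwpos.ne']; field_simp
    rw [e1, Real.mul_rpow (by positivity) hwpos.le, e2]
    have e3 : (2 / Real.exp 1) ^ p * (Real.exp 1 / 2) ^ p = 1 := by
      rw [← Real.mul_rpow (by positivity) (by positivity)]
      have : 2 / Real.exp 1 * (Real.exp 1 / 2) = 1 := by
        have := (Real.exp_pos 1).ne'
        field_simp
      rw [this, Real.one_rpow]
    have e4 : (2 / Real.exp 1) ^ p * G = Real.exp (-1) * (K1 + G) := by
      calc (2 / Real.exp 1) ^ p * G = (2 / Real.exp 1) ^ p * ((Real.exp 1 / 2) ^ p *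
            (Real.exp (-1) * (K1 + G))) := by rw [← hG]
        _ = ((2 / Real.exp 1) ^ p * (Real.exp 1 / 2) ^ p) * (Real.exp (-1) * (K1 + G)) := by ring
        _ = _ := by rw [e3, one_mul]
    calc (2 / Real.exp 1) ^ p * w ^ p * G = ((2 / Real.exp 1) ^ p * G) * w ^ p := by ring
      _ = _ := by rw [e4]
  have hwq : 1 + (p - 1) * (t ^ 2 / 2 - t ^ 3 / 2) ≤ w ^ (p - 1) := by
    have h1 : 1 + (p - 1) * Real.log w ≤ w ^ (p - 1) := by
      rw [Real.rpow_def_of_pos hwpos]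
      linarith [Real.add_one_le_exp (Real.log w * (p - 1))]
    have h2 := mul_le_mul_of_nonneg_left (aux_log t ht0 ht1) (by linarith : 0 ≤ p - 1)
    rw [hlw] at h1
    linarith
  have hq : 0 ≤ t ^ 2 / 2 - t ^ 3 / 2 := by nlinarith [sq_nonneg t]
  have hs : 9.5 * (t ^ 2 / 2 - t ^ 3 / 2) ≤ (K1 + G) * ((p - 1) * (t ^ 2 / 2 - t ^ 3 / 2)) := by
    rw [← mul_assoc]
    refine mul_le_mul_of_nonneg_right ?_ hq
    nlinarith
  have hnum := aux_num t _ ht0 ht1 hs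
  have hKG := mul_le_mul_of_nonneg_left hwq (by linarith : 0 ≤ K1 + G)
  have hfin : Kt + G + t * Real.exp (1 - t) * (2 * t ^ 3 + 3 * t ^ 2 + 1) ≤
      (K1 + G) * w ^ (p - 1) := by linarith
  have hfin2 := mul_le_mul_of_nonneg_left hfin
    (by positivity : 0 ≤ Real.exp (-1) * w)
  rw [hR]
  have e5 : Real.exp (-1) * w = Real.exp (t - 1) / (1 + t) := by
    rw [hw, ← mul_div_assoc, ← Real.exp_add]; congr 2; ring
  have e6 : Real.exp (t - 1) * Real.exp (1 - t) = 1 := by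
    rw [← Real.exp_add]; simp
  have e7 : Real.exp (-1) * w * (Kt + G + t * Real.exp (1 - t) * (2 * t ^ 3 + 3 * t ^ 2 + 1))
      = Real.exp (t - 1) / (1 + t) * (Kt + G) + t / (1 + t) * (2 * t ^ 3 + 3 * t ^ 2 + 1) := by
    rw [e5]
    field_simp
    linear_combination (t * (2 * t ^ 3 + 3 * t ^ 2 + 1)) * e6
  linarith

theorem stmt_19 {Ω : Type} [MeasurableSpace Ω] (P : Measure Ω) [IsProbabilityMeasure P]
    (E E' : Ω → ℝ) (hE : HasDensity P E expPDF) (hE' : HasDensity P E' expPDF)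
    (hind : IndepFun E E' P)
    (p₀ : ℝ) (hp₀l : 2.9414 < p₀) (hp₀u : p₀ < 2.9415)
    (hp₀ : Real.Gamma (p₀ + 1) = (Real.exp 1 / 2) ^ p₀ * ∫ ω, |E ω - 1| ^ p₀ ∂P)
    (hp₀uniq : ∀ p : ℝ, 1 < p →
      Real.Gamma (p + 1) = (Real.exp 1 / 2) ^ p * (∫ ω, |E ω - 1| ^ p ∂P) → p = p₀)
    (t : ℝ) (ht0 : 0 ≤ t) (ht1 : t ≤ 1 / 5) :
    (∫ ω, |((E ω - 1) - t * (E' ω - 1)) / ((2 / Real.exp 1) * Real.exp t / (1 + t))| ^ p₀ ∂P) ≤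
      Real.Gamma (p₀ + 1) ∧
    (Real.exp (t - 1) / (1 + t)) *
        ((∫ x in (0 : ℝ)..(1 - t), x ^ p₀ * Real.exp x) + Real.Gamma (p₀ + 1)) +
      (t / (1 + t)) * (2 * t ^ 3 + 3 * t ^ 2 + 1) ≤
      ((2 / Real.exp 1) * Real.exp t / (1 + t)) ^ p₀ * Real.Gamma (p₀ + 1) := by
  have hp : 0 < p₀ := by linarith
  obtain ⟨mE, lE⟩ := hE
  obtain ⟨mE', lE'⟩ := hE'
  have hrp : ∀ f : ℝ × ℝ → ℝ, Continuous f → Continuous (fun z => |f z| ^ p₀) := fun f hf =>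
    Continuous.rpow_const hf.abs (fun _ => Or.inr hp.le)
  have hcE : ∫ ω, |E ω - 1| ^ p₀ ∂P = Real.exp (-1) *
      ((∫ u in (0:ℝ)..1, u ^ p₀ * Real.exp u) + Real.Gamma (p₀ + 1)) := by
    have hc : Continuous (fun x : ℝ => |x - 1| ^ p₀) :=
      Continuous.rpow_const (by fun_prop) (fun _ => Or.inr hp.le)
    have := integral_map mE.aemeasurable (μ := P) (f := fun x : ℝ => |x - 1| ^ p₀)
      hc.aestronglyMeasurable
    rw [← this, lE, aux_int_density, aux_inner p₀ hp 1 zero_le_one]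
  rw [hcE] at hp₀
  have hsec := aux_second p₀ hp₀l hp₀u hp₀ t ht0 ht1
  refine ⟨?_, hsec⟩
  set m := (2 / Real.exp 1) * Real.exp t / (1 + t) with hm
  have hmpos : 0 < m := by positivity
  set f : ℝ × ℝ → ℝ := fun z => |(z.2 - 1) - t * (z.1 - 1)| ^ p₀ with hf
  have hfc : Continuous f := hrp _ (by fun_prop)
  set ν : Measure ℝ := volume.withDensity (fun x => ENNReal.ofReal (expPDF x)) with hν
  have hνp : IsProbabilityMeasure ν := by
    rw [← lE]; exact Measure.isProbabilityMeasure_map mE.aemeasurable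
  have hmap : Measure.map (fun ω => (E' ω, E ω)) P = ν.prod ν := by
    have := (indepFun_iff_map_prod_eq_prod_map_map mE'.aemeasurable mE.aemeasurable).mp hind.symm
    rw [this, lE, lE']
  have hbound : ∫ z, f z ∂(ν.prod ν) ≤ m ^ p₀ * Real.Gamma (p₀ + 1) := by
    by_cases hi : Integrable f (ν.prod ν)
    · rw [integral_prod f hi]
      have hi2 := hi.integral_prod_left
      set h : ℝ → ℝ := fun c => Real.exp (-c) *
        ((∫ u in (0:ℝ)..c, u ^ p₀ * Real.exp u) + Real.Gamma (p₀ + 1)) with hh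
      have hin : ∀ y ∈ Ioi (0:ℝ), Real.exp (-y) * ∫ x, f (y, x) ∂ν =
          Real.exp (-y) * h (1 - t + t * y) := by
        intro y hy
        have hy0 : 0 ≤ t * y := mul_nonneg ht0 (le_of_lt hy)
        rw [hν, aux_int_density, hh]
        simp only
        rw [← aux_inner p₀ hp (1 - t + t * y) (by linarith)]
        congr 2
        ext x
        simp only [hf]
        congr 3
        ring
      have hi3 := aux_integrable_density _ hi2
      have hi4 := (integrableOn_congr_fun hin measurableSet_Ioi).mp hi3
      have hout := aux_outer p₀ hp (by linarith) t ht0 (by linarith) h (fun c => rfl) hi4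
      have : ∫ y, ∫ x, f (y, x) ∂ν ∂ν = ∫ y in Ioi (0:ℝ), Real.exp (-y) * h (1 - t + t * y) := by
        conv_lhs => rw [hν]
        rw [aux_int_density]
        exact setIntegral_congr_fun measurableSet_Ioi hin
      rw [this]
      refine hout.trans (le_trans (le_of_eq ?_) hsec)
      simp only [hh]
      have : -(1 - t) = t - 1 := by ring
      rw [this]
      ring
    · rw [integral_undef hi]
      exact mul_nonneg (Real.rpow_nonneg hmpos.le _) (Real.Gamma_pos_of_pos (by linarith)).le
  rw [← hmap, integral_map (by fun_prop) hfc.aestronglyMeasurable] at hbound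
  have hdiv : ∀ ω, |((E ω - 1) - t * (E' ω - 1)) / m| ^ p₀ = f (E' ω, E ω) / m ^ p₀ := by
    intro ω
    rw [abs_div, abs_of_pos hmpos, Real.div_rpow (abs_nonneg _) hmpos.le]
  simp_rw [hdiv]
  rw [integral_div, div_le_iff₀ (Real.rpow_pos_of_pos hmpos _)]
  linarith
end
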